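/- Let N be a natural number and let ε, δ be real numbers in the open interval (0,1). If N ≥ ln(1/δ)/ln(1/(1−ε)) − 1, then the probability that a Beta(N+1, 1)-distributed random variable (i.e., one with density p ↦ (N+1)·p^N on [0,1]) exceeds 1−ε is at least 1−δ; equivalently, ∫_{1−ε}^{1} (N+1)·p^N dp ≥ 1 − δ. -/

import Mathlib

theorem beta_posterior_confidence
    (N : ℕ) (ε δ : ℝ) (hε : ε ∈ Set.Ioo (0:ℝ) 1) (hδ : δ ∈ Set.Ioo (0:ℝ) 1)
    (hN : (N : ℝ) ≥ Real.log (1/δ) / Real.log (1/(1-ε)) - 1) :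
    ∫ p in (1-ε)..1, ((N : ℝ) + 1) * p ^ N ≥ 1 - δ := by
  obtain ⟨hε0, hε1⟩ := hε
  obtain ⟨hδ0, hδ1⟩ := hδ
  have h1 : 0 < 1 - ε := by linarith
  have hneg : Real.log (1 - ε) < 0 := Real.log_neg h1 (by linarith)
  have hint : ∫ p in (1-ε)..1, ((N : ℝ) + 1) * p ^ N = 1 - (1 - ε) ^ (N + 1) := by
    have hne : (N : ℝ) + 1 ≠ 0 := by positivity
    rw [intervalIntegral.integral_const_mul, integral_pow, one_pow]
    field_simp
  have key : (1 - ε) ^ (N + 1) ≤ δ := by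
    rw [one_div, one_div, Real.log_inv, Real.log_inv] at hN
    have h2 : -Real.log δ / -Real.log (1 - ε) ≤ (N : ℝ) + 1 := by linarith
    rw [div_le_iff₀ (by linarith)] at h2
    rw [← Real.log_le_log_iff (pow_pos h1 _) hδ0, Real.log_pow]
    push_cast
    linarith
  rw [hint]
  linarith
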